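/- arXiv:math/0511546 — 2 statements merged into one kernel-verified Lean document; each statement's English description precedes it below -/
import Mathlib

section
/- For every integer t ≥ 1, setting n = 6t + 1, the monomial X^{3t+1} does not belong to the ideal of (ZMod 2)[X, Y] generated by g_{6t−1}, g_{6t}, g_{6t+1}, i.e. X^{3t+1} ∉ Ideal.span {g_{6t−1}, g_{6t}, g_{6t+1}}. (Case n ≡ 1 mod 6 in the proof of Proposition B(b).) -/
open MvPolynomial

/-- `Xp` plays the role of the Stiefel–Whitney class `w₂` (weight 2). -/
noncomputable def Xp : MvPolynomial (Fin 2) (ZMod 2) := X 0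

/-- `Yp` plays the role of the Stiefel–Whitney class `w₃` (weight 3). -/
noncomputable def Yp : MvPolynomial (Fin 2) (ZMod 2) := X 1

/-- The polynomial `g κ = Σ_{2i ≤ κ ≤ 3i} C(i, 3i−κ) X^{3i−κ} Y^{κ−2i}` over `ZMod 2`. -/
noncomputable def g (κ : ℕ) : MvPolynomial (Fin 2) (ZMod 2) :=
  ∑ i ∈ Finset.range (κ + 1),
    if 2 * i ≤ κ ∧ κ ≤ 3 * i then
      (Nat.choose i (3 * i - κ) : ZMod 2) • (Xp ^ (3 * i - κ) * Yp ^ (κ - 2 * i))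
    else 0

lemma coeff_XY (d : Fin 2 →₀ ℕ) (a b : ℕ) :
    coeff d (Xp ^ a * Yp ^ b) = if a = d 0 ∧ b = d 1 then 1 else 0 := by
  have h : Xp ^ a * Yp ^ b
      = monomial (Finsupp.single (0 : Fin 2) a + Finsupp.single 1 b) (1 : ZMod 2) := by
    simp [Xp, Yp, X_pow_eq_monomial, monomial_mul]
  rw [h, coeff_monomial]
  congr 1
  rw [Finsupp.ext_iff, Fin.forall_fin_two]
  simp

lemma coeff_g (κ : ℕ) (d : Fin 2 →₀ ℕ) :
    coeff d (g κ) = if 2 * d 0 + 3 * d 1 = κ then ((d 0 + d 1).choose (d 0) : ZMod 2) else 0 := by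
  unfold g
  rw [coeff_sum]
  rw [Finset.sum_eq_single (d 0 + d 1)]
  · split_ifs with h1 h2 h2
    · rw [coeff_smul, coeff_XY, if_pos (by omega)]
      rw [show 3 * (d 0 + d 1) - κ = d 0 by omega]; simp
    · rw [coeff_smul, coeff_XY, if_neg (by omega)]; simp
    · omega
    · simp
  · intro i _ hi
    split_ifs with h1
    · rw [coeff_smul, coeff_XY, if_neg (by omega)]; simp
    · simp
  · intro h
    rw [Finset.mem_range] at h
    rw [if_neg (by omega)]; simp

lemma coeff_mono_g (κ : ℕ) (d s : Fin 2 →₀ ℕ) (c : ZMod 2) :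
    coeff d (monomial s c * g κ) =
      if s 0 ≤ d 0 ∧ s 1 ≤ d 1 ∧ 2 * (d 0 - s 0) + 3 * (d 1 - s 1) = κ then
        c * ((d 0 - s 0 + (d 1 - s 1)).choose (d 0 - s 0) : ZMod 2) else 0 := by
  have h : s ≤ d ↔ s 0 ≤ d 0 ∧ s 1 ≤ d 1 := by
    rw [Finsupp.le_def, Fin.forall_fin_two]
  rw [coeff_monomial_mul', coeff_g]
  have e0 : d 0 - s 0 = (d - s) 0 := rfl
  have e1 : d 1 - s 1 = (d - s) 1 := rfl
  rw [e0, e1]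
  generalize (d - s) 0 = u
  generalize (d - s) 1 = v
  by_cases h1 : s ≤ d
  · have h2 := h.1 h1
    by_cases h3 : 2 * u + 3 * v = κ <;> simp [h1, h2, h3]
  · rw [if_neg h1, if_neg (fun h2 => h1 (h.2 ⟨h2.1, h2.2.1⟩))]

/-- The functional separating the monomial from the ideal. -/
noncomputable def phi (t : ℕ) (p : MvPolynomial (Fin 2) (ZMod 2)) : ZMod 2 :=
  coeff (Finsupp.single 0 (3 * t + 1)) p
    + coeff (Finsupp.single 0 1 + Finsupp.single 1 (2 * t)) p

lemma phi_add (t : ℕ) (p q) : phi t (p + q) = phi t p + phi t q := by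
  simp only [phi, coeff_add]; ring

lemma phi_mono (t : ℕ) (ht : 1 ≤ t) (κ : ℕ) (hκ : κ = 6 * t - 1 ∨ κ = 6 * t ∨ κ = 6 * t + 1)
    (s : Fin 2 →₀ ℕ) (c : ZMod 2) : phi t (monomial s c * g κ) = 0 := by
  unfold phi
  rw [coeff_mono_g, coeff_mono_g]
  simp only [Finsupp.add_apply, Finsupp.single_apply]
  simp only [Fin.isValue, if_true, zero_ne_one, one_ne_zero, if_false, add_zero, zero_add]
  generalize s 0 = a
  generalize s 1 = b
  rcases hκ with h | h | h
  · rw [if_neg (by omega), zero_add]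
    split_ifs with h1
    · obtain ⟨rfl, rfl⟩ : a = 0 ∧ b = 1 := by omega
      rw [show 1 - 0 + (2 * t - 1) = 2 * t by omega]
      have : (2 : ZMod 2) = 0 := rfl
      simp [this]
    · rfl
  · by_cases h1 : a = 1 ∧ b = 0
    · obtain ⟨rfl, rfl⟩ := h1
      rw [if_pos (by omega), if_pos (by omega)]
      simp [CharTwo.add_self_eq_zero]
    · rw [if_neg (by omega), if_neg (by omega), zero_add]
  · rw [if_neg (by omega), if_neg (by omega), zero_add]

lemma phi_mul (t : ℕ) (ht : 1 ≤ t) (κ : ℕ) (hκ : κ = 6 * t - 1 ∨ κ = 6 * t ∨ κ = 6 * t + 1)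
    (p : MvPolynomial (Fin 2) (ZMod 2)) : phi t (p * g κ) = 0 := by
  induction p using MvPolynomial.induction_on' with
  | monomial s c => exact phi_mono t ht κ hκ s c
  | add p q hp hq => rw [add_mul, phi_add, hp, hq, add_zero]

/-- Proposition B(b), case `n = 6t + 1`: `X^(3t+1)` is not in the ideal
`(g (6t−1), g (6t), g (6t+1))`. -/
theorem x_pow_not_mem_span_6t1 (t : ℕ) (ht : 1 ≤ t) :
    Xp ^ (3 * t + 1) ∉ Ideal.span ({g (6 * t - 1), g (6 * t), g (6 * t + 1)} :
      Set (MvPolynomial (Fin 2) (ZMod 2))) := by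
  intro h
  rw [Ideal.mem_span_insert] at h
  obtain ⟨a, z, hz, h⟩ := h
  rw [Ideal.mem_span_pair] at hz
  obtain ⟨b, c, rfl⟩ := hz
  have h2 := congrArg (phi t) h
  rw [phi_add, phi_add, phi_mul t ht _ (by simp), phi_mul t ht _ (by simp),
    phi_mul t ht _ (by simp)] at h2
  have h3 := coeff_XY (Finsupp.single 0 (3 * t + 1)) (3 * t + 1) 0
  have h4 := coeff_XY (Finsupp.single 0 1 + Finsupp.single 1 (2 * t)) (3 * t + 1) 0
  rw [pow_zero, mul_one] at h3 h4
  unfold phi at h2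
  rw [h3, h4, if_pos (by simp), if_neg (by simp; omega)] at h2
  simp at h2
end

section
/- For every integer t ≥ 2, setting n = 6t + 3, the monomial X^{3t+2} does not belong to the ideal of (ZMod 2)[X, Y] generated by g_{6t+1}, g_{6t+2}, g_{6t+3}, i.e. X^{3t+2} ∉ Ideal.span {g_{6t+1}, g_{6t+2}, g_{6t+3}}. (Case n ≡ 3 mod 6, n ≠ 9, in the proof of Proposition B(b).) -/
open MvPolynomial

noncomputable def mon (a b : ℕ) : Fin 2 →₀ ℕ := Finsupp.single 0 a + Finsupp.single 1 b

lemma mon_le (a b x y : ℕ) : mon x y ≤ mon a b ↔ x ≤ a ∧ y ≤ b := by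
  rw [Finsupp.le_def]
  simp [mon, Fin.forall_fin_two]

lemma mon_sub (a b x y : ℕ) : mon a b - mon x y = mon (a - x) (b - y) := by
  ext i
  fin_cases i <;> simp [mon]

lemma XY_eq (x y : ℕ) : Xp ^ x * Yp ^ y = monomial (mon x y) 1 := by
  simp [Xp, Yp, X_pow_eq_monomial, monomial_mul, mon]

lemma coeff_mul_XY (A : MvPolynomial (Fin 2) (ZMod 2)) (a b x y : ℕ) :
    coeff (mon a b) (A * (Xp ^ x * Yp ^ y)) =
      if x ≤ a ∧ y ≤ b then coeff (mon (a - x) (b - y)) A else 0 := by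
  rw [XY_eq, coeff_mul_monomial', mon_sub]
  simp [mon_le]

lemma coeff_mul_g (A : MvPolynomial (Fin 2) (ZMod 2)) (a b κ : ℕ) :
    coeff (mon a b) (A * g κ) = ∑ i ∈ Finset.range (κ + 1),
      if (2 * i ≤ κ ∧ κ ≤ 3 * i) ∧ 3 * i - κ ≤ a ∧ κ - 2 * i ≤ b then
        (Nat.choose i (3 * i - κ) : ZMod 2) * coeff (mon (a - (3 * i - κ)) (b - (κ - 2 * i))) A
      else 0 := by
  rw [g, Finset.mul_sum, coeff_sum]
  refine Finset.sum_congr rfl fun i _ => ?_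
  by_cases h : 2 * i ≤ κ ∧ κ ≤ 3 * i
  · rw [if_pos h, mul_smul_comm, coeff_smul, coeff_mul_XY]
    by_cases h2 : 3 * i - κ ≤ a ∧ κ - 2 * i ≤ b
    · rw [if_pos h2, if_pos ⟨h, h2⟩, smul_eq_mul]
    · rw [if_neg h2, if_neg (fun h' => h2 h'.2), smul_zero]
  · rw [if_neg h, if_neg (fun h' => h h'.1), mul_zero, coeff_zero]

lemma coeff1 (A : MvPolynomial (Fin 2) (ZMod 2)) (a b κ : ℕ) (h : 2 * a + 3 * (b + 1) = κ + 3) :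
    coeff (mon a (b + 1)) (A * g κ) = (Nat.choose (a + b) a : ZMod 2) * coeff (mon 0 1) A := by
  rw [coeff_mul_g, Finset.sum_eq_single (a + b)]
  · rw [if_pos (by omega)]
    have h1 : 3 * (a + b) - κ = a := by omega
    have h2 : κ - 2 * (a + b) = b := by omega
    rw [h1, h2]; simp
  · intro i _ hi
    rw [if_neg (by omega)]
  · intro hi
    rw [Finset.mem_range] at hi
    omega

lemma coeff1' (A : MvPolynomial (Fin 2) (ZMod 2)) (a κ : ℕ) (h : 2 * a = κ + 3) :
    coeff (mon a 0) (A * g κ) = 0 := by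
  rw [coeff_mul_g, Finset.sum_eq_zero]
  intro i _
  rw [if_neg (by omega)]

lemma coeff2 (A : MvPolynomial (Fin 2) (ZMod 2)) (a b κ : ℕ) (h : 2 * (a + 1) + 3 * b = κ + 2) :
    coeff (mon (a + 1) b) (A * g κ) = (Nat.choose (a + b) a : ZMod 2) * coeff (mon 1 0) A := by
  rw [coeff_mul_g, Finset.sum_eq_single (a + b)]
  · rw [if_pos (by omega)]
    have h1 : 3 * (a + b) - κ = a := by omega
    have h2 : κ - 2 * (a + b) = b := by omega
    rw [h1, h2]; simp
  · intro i _ hi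
    rw [if_neg (by omega)]
  · intro hi
    rw [Finset.mem_range] at hi
    omega

lemma coeff3 (A : MvPolynomial (Fin 2) (ZMod 2)) (a b κ : ℕ) (h : 2 * a + 3 * b = κ + 1) :
    coeff (mon a b) (A * g κ) = 0 := by
  rw [coeff_mul_g, Finset.sum_eq_zero]
  intro i _
  rw [if_neg (by omega)]

lemma coeff_Xpow (n a b : ℕ) : coeff (mon a b) (Xp ^ n) = if a = n ∧ b = 0 then 1 else 0 := by
  have h := XY_eq n 0
  rw [pow_zero, mul_one] at h
  rw [h, coeff_monomial]
  refine if_congr ?_ rfl rfl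
  constructor
  · intro h
    have h0 := DFunLike.congr_fun h 0
    have h1 := DFunLike.congr_fun h 1
    simp [mon] at h0 h1
    omega
  · rintro ⟨rfl, rfl⟩; rfl

lemma odd_choose_five (s : ℕ) : Nat.choose (8 * s + 5) 5 % 2 = 1 := by
  have : Fact (Nat.Prime 2) := ⟨Nat.prime_two⟩
  have l := fun n k => @Choose.choose_modEq_choose_mod_mul_choose_div_nat n k 2 _
  have h1 := l (8 * s + 5) 5
  have h2 := l (4 * s + 2) 2
  have h3 := l (2 * s + 1) 1
  rw [show (8 * s + 5) % 2 = 1 by omega, show (8 * s + 5) / 2 = 4 * s + 2 by omega] at h1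
  rw [show (4 * s + 2) % 2 = 0 by omega, show (4 * s + 2) / 2 = 2 * s + 1 by omega] at h2
  simp [Nat.ModEq] at h1 h2 h3
  omega

/-- Proposition B(b), case `n = 6t + 3` with `t ≥ 2`: `X^(3t+2)` is not in the ideal
`(g (6t+1), g (6t+2), g (6t+3))`. -/
theorem x_pow_not_mem_span_6t3 (t : ℕ) (ht : 2 ≤ t) :
    Xp ^ (3 * t + 2) ∉ Ideal.span ({g (6 * t + 1), g (6 * t + 2), g (6 * t + 3)} :
      Set (MvPolynomial (Fin 2) (ZMod 2))) := by
  intro hmem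
  rw [Ideal.mem_span_insert] at hmem
  obtain ⟨A, z, hz, hA⟩ := hmem
  rw [Ideal.mem_span_pair] at hz
  obtain ⟨B, C, rfl⟩ := hz
  have e0 := congrArg (coeff (mon (3 * t + 1 + 1) 0)) hA
  rw [coeff_add, coeff_add, coeff1' _ _ _ (by omega), coeff2 _ _ _ _ (by omega),
    coeff3 _ _ _ _ (by omega), coeff_Xpow, if_pos (by omega)] at e0
  have key : ∀ a b, 2 * a + 3 * b + 5 = 6 * t + 4 →
      0 = (Nat.choose (a + 1 + b) (a + 1) : ZMod 2) * coeff (mon 0 1) A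
        + (Nat.choose (a + 1 + b) a : ZMod 2) := by
    intro a b hab
    have e := congrArg (coeff (mon (a + 1) (b + 1))) hA
    rw [coeff_add, coeff_add, coeff1 _ _ _ _ (by omega), coeff2 _ _ _ _ (by omega),
      coeff3 _ _ _ _ (by omega), coeff_Xpow, if_neg (by omega)] at e
    have hB : coeff (mon 1 0) B = 1 := by simpa using e0.symm
    rw [hB, mul_one, add_zero, show a + (b + 1) = a + 1 + b by ring] at e
    exact e
  generalize coeff (mon 0 1) A = α at key
  have hα : α = 1 ∧ t % 2 = 1 := by
    have k := key 1 (2 * t - 1) (by omega)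
    rw [show 1 + 1 + (2 * t - 1) = 2 * t + 1 by omega, Nat.choose_one_right, Nat.choose_two_right,
      show (2 * t + 1) * (2 * t + 1 - 1) / 2 = (2 * t + 1) * t by
        rw [Nat.add_sub_cancel]
        apply Nat.div_eq_of_eq_mul_left (by norm_num); ring] at k
    have h2 : (2 : ZMod 2) = 0 := rfl
    push_cast at k
    rw [h2, zero_mul, zero_add, one_mul] at k
    rcases Nat.mod_two_eq_zero_or_one t with h | h
    · have : (t : ZMod 2) = 0 := (ZMod.natCast_eq_zero_iff _ _).2 (Nat.dvd_of_mod_eq_zero h)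
      rw [this] at k; simp at k
    · refine ⟨?_, h⟩
      have : (t : ZMod 2) = 1 := by
        rw [← Nat.cast_one, ZMod.natCast_eq_natCast_iff]; exact h
      rw [this, one_mul] at k
      clear key; revert k; revert α; decide
  obtain ⟨rfl, hodd⟩ := hα
  have key2 : ∀ a b, 2 * a + 3 * b + 5 = 6 * t + 4 → Nat.choose (a + 1 + b + 1) (a + 1) % 2 = 0 := by
    intro a b hab
    have k := key a b hab
    rw [mul_one, ← Nat.cast_add, add_comm, ← Nat.choose_succ_succ'] at k
    exact Nat.mod_eq_zero_of_dvd ((ZMod.natCast_eq_zero_iff _ _).1 k.symm)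
  have h4 : t % 4 = 1 ∨ t % 4 = 3 := by omega
  rcases h4 with h | h
  · obtain ⟨s, rfl⟩ : ∃ s, t = 4 * s + 1 := ⟨t / 4, by omega⟩
    have k := key2 4 (8 * s - 1) (by omega)
    rw [show 4 + 1 + (8 * s - 1) + 1 = 8 * s + 5 by omega] at k
    have := odd_choose_five s
    simp at k
    omega
  · obtain ⟨s, rfl⟩ : ∃ s, t = 4 * s + 3 := ⟨t / 4, by omega⟩
    have k := key2 (12 * s + 7) 1 (by omega)
    rw [show 12 * s + 7 + 1 + 1 + 1 = (12 * s + 8) + 2 by omega, Nat.choose_symm_add,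
      Nat.choose_two_right, show (12 * s + 8 + 2) * (12 * s + 8 + 2 - 1) / 2
        = 2 * (36 * s ^ 2 + 57 * s + 22) + 1 by
        rw [show 12 * s + 8 + 2 - 1 = 12 * s + 9 by omega]
        apply Nat.div_eq_of_eq_mul_left (by norm_num); ring] at k
    omega
end
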